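/- Let P be an n-Vee, K a field, and let I and M be convex representations of P. Then the K-vector space of morphisms of representations from I to M has dimension at most 1; that is, Hom(I, M) is isomorphic to K or is zero. -/

import Mathlib

namespace GPM

/-- A subset `S` is connected if any two of its elements can be joined by a finite
sequence of elements of `S` in which consecutive elements are comparable. -/
def ConnectedIn {Q : Type*} [Preorder Q] (S : Set Q) : Prop :=
  ∀ x ∈ S, ∀ y ∈ S,
    Relation.ReflTransGen (fun a b => a ∈ S ∧ b ∈ S ∧ (a ≤ b ∨ b ≤ a)) x y

/-- `P` is an n-Vee with (unique) minimal element `m`: `m` is the unique minimal element,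
the interval `[m, M]` is totally ordered for every maximal element `M`, and
`[m, M] ∩ [m, M'] = {m}` for distinct maximal elements `M, M'`. -/
structure IsNVee (P : Type*) [PartialOrder P] (m : P) : Prop where
  isMin : IsMin m
  eq_of_isMin : ∀ p : P, IsMin p → p = m
  icc_chain : ∀ M : P, IsMax M → ∀ x ∈ Set.Icc m M, ∀ y ∈ Set.Icc m M, x ≤ y ∨ y ≤ x
  icc_inter : ∀ M M' : P, IsMax M → IsMax M' → M ≠ M' →
      Set.Icc m M ∩ Set.Icc m M' = {m}

/-- A representation of a poset `P` with values in `K`-vector spaces. -/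
structure Rep (P : Type*) [Preorder P] (K : Type*) [Field K] where
  V : P → Type*
  [addCommGroup : ∀ p, AddCommGroup (V p)]
  [module : ∀ p, Module K (V p)]
  map : ∀ {p q : P}, p ≤ q → V p →ₗ[K] V q
  map_refl : ∀ p : P, map (le_refl p) = LinearMap.id
  map_comp : ∀ {p q r : P} (hpq : p ≤ q) (hqr : q ≤ r),
      (map hqr).comp (map hpq) = map (hpq.trans hqr)

attribute [instance] Rep.addCommGroup Rep.module

/-- A morphism of representations (a natural transformation). -/
structure RepHom {P : Type*} [Preorder P] {K : Type*} [Field K] (M N : Rep P K) where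
  app : ∀ p, M.V p →ₗ[K] N.V p
  natural : ∀ {p q : P} (h : p ≤ q), (N.map h).comp (app p) = (app q).comp (M.map h)

/-- The submodule of `K` underlying the convex representation of `S` at the point `p`:
all of `K` on `S`, and `0` off `S`. -/
noncomputable def convexSub (K : Type*) [Field K] {Q : Type*} (S : Set Q) (p : Q) :
    Submodule K K :=
  @ite _ (p ∈ S) (Classical.dec _) ⊤ ⊥

theorem convexSub_pos (K : Type*) [Field K] {Q : Type*} {S : Set Q} {p : Q} (h : p ∈ S) :
    convexSub K S p = ⊤ := by
  rw [convexSub, if_pos h]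

theorem convexSub_neg (K : Type*) [Field K] {Q : Type*} {S : Set Q} {p : Q} (h : p ∉ S) :
    convexSub K S p = ⊥ := by
  rw [convexSub, if_neg h]

/-- The canonical map between the fibers of the convex representations of `S` and `T`:
the identity of `K` when both fibers are `K`, and zero otherwise. -/
noncomputable def phiMap (K : Type*) [Field K] {Q : Type*} (S T : Set Q) (p q : Q) :
    ↥(convexSub K S p) →ₗ[K] ↥(convexSub K T q) :=
  @dite _ (p ∈ S ∧ q ∈ T) (Classical.dec _)
    (fun h => Submodule.inclusion (le_of_eq (by rw [convexSub_pos K h.1, convexSub_pos K h.2])))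
    (fun _ => 0)

theorem phiMap_neg (K : Type*) [Field K] {Q : Type*} {S T : Set Q} {p q : Q}
    (h : ¬(p ∈ S ∧ q ∈ T)) : phiMap K S T p q = 0 := by
  rw [phiMap, dif_neg h]

/-- The convex representation with support the interval-convex set `S`:
`K` at points of `S`, `0` elsewhere, with identity structure maps inside `S`. -/
noncomputable def convexRep (K : Type*) [Field K] {Q : Type*} [Preorder Q]
    (S : Set Q) (hS : S.OrdConnected) : Rep Q K where
  V p := ↥(convexSub K S p)
  map {p q} _ := phiMap K S S p q
  map_refl p := by
    show phiMap K S S p p = LinearMap.id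
    by_cases hp : p ∈ S
    · rw [phiMap, dif_pos ⟨hp, hp⟩]
      rfl
    · rw [phiMap_neg (K := K) (by tauto)]
      apply LinearMap.ext
      intro x
      have hx : x = 0 := by
        apply Subtype.ext
        have hle : convexSub K S p ≤ ⊥ := le_of_eq (convexSub_neg K hp)
        simpa using hle x.2
      simp [hx]
  map_comp {p q r} hpq hqr := by
    show (phiMap K S S q r).comp (phiMap K S S p q) = phiMap K S S p r
    by_cases hp : p ∈ S
    · by_cases hr : r ∈ S
      · have hq : q ∈ S := hS.out hp hr ⟨hpq, hqr⟩
        rw [phiMap, phiMap, phiMap, dif_pos ⟨hq, hr⟩, dif_pos ⟨hp, hq⟩, dif_pos ⟨hp, hr⟩]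
        rfl
      · rw [phiMap_neg (K := K) (S := S) (T := S) (p := q) (q := r) (by tauto),
          phiMap_neg (K := K) (S := S) (T := S) (p := p) (q := r) (by tauto)]
        simp
    · rw [phiMap_neg (K := K) (S := S) (T := S) (p := p) (q := q) (by tauto),
        phiMap_neg (K := K) (S := S) (T := S) (p := p) (q := r) (by tauto)]
      simp

theorem IsNVee.le {P : Type*} [PartialOrder P] [Finite P] {m : P} (hP : IsNVee P m) (p : P) :
    m ≤ p := by
  obtain ⟨a, hap, ha⟩ := Finite.exists_le_minimal (p := fun _ : P => True) (a := p) trivial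
  rw [minimal_true] at ha
  exact hP.eq_of_isMin a ha ▸ hap

/-- An element other than the minimum of an n-Vee lies below at most one maximal element. -/
theorem IsNVee.isMax_unique {P : Type*} [PartialOrder P] [Finite P] {m : P} (hP : IsNVee P m)
    {x M M' : P} (hx : x ≠ m) (hM : IsMax M) (hM' : IsMax M') (hxM : x ≤ M) (hxM' : x ≤ M') :
    M = M' := by
  by_contra hne
  have hmem : x ∈ Set.Icc m M ∩ Set.Icc m M' := ⟨⟨hP.le x, hxM⟩, ⟨hP.le x, hxM'⟩⟩
  rw [hP.icc_inter M M' hM hM' hne] at hmem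
  exact hx hmem

/-- A connected subset of an n-Vee that avoids the minimum lies below a single maximal element,
hence is a chain. -/
theorem IsNVee.comparable_of_notMem {P : Type*} [PartialOrder P] [Finite P] {m : P}
    (hP : IsNVee P m) {S : Set P} (hS : ConnectedIn S) (hm : m ∉ S) {x y : P} (hx : x ∈ S)
    (hy : y ∈ S) : x ≤ y ∨ y ≤ x := by
  obtain ⟨M, hxM, hM⟩ := Finite.exists_le_maximal (p := fun _ : P => True) (a := x) trivial
  rw [maximal_true] at hM
  have hyM : y ≤ M := by
    induction hS x hx y hy with
    | refl => exact hxM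
    | @tail b c _ hbc ih =>
      obtain ⟨hb, -, hbc | hcb⟩ := hbc
      · obtain ⟨M', hcM', hM'⟩ := Finite.exists_le_maximal (p := fun _ : P => True) (a := c) trivial
        rw [maximal_true] at hM'
        have hbm : b ≠ m := fun h => hm (h ▸ hb)
        rwa [hP.isMax_unique hbm hM hM' (ih hb) (hbc.trans hcM')]
      · exact hcb.trans (ih hb)
  exact hP.icc_chain M hM x ⟨hP.le x, hxM⟩ y ⟨hP.le y, hyM⟩

section Coeff

variable {P : Type*} [Preorder P] {K : Type*} [Field K] {S T : Set P}
  {hS : S.OrdConnected} {hT : T.OrdConnected}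

/-- The component at `p` of a morphism of convex representations, as a map of submodules of `K`. -/
noncomputable def RepHom.fiber (f : RepHom (convexRep K S hS) (convexRep K T hT)) (p : P) :
    convexSub K S p →ₗ[K] convexSub K T p :=
  f.app p

/-- The scalar by which a morphism of convex representations acts at `p`. -/
noncomputable def RepHom.coeff (f : RepHom (convexRep K S hS) (convexRep K T hT)) (p : P) : K :=
  @dite _ (p ∈ S) (Classical.dec _)
    (fun h => (f.fiber p ⟨1, convexSub_pos K h ▸ Submodule.mem_top⟩ : K))
    (fun _ => 0)

theorem RepHom.coeff_of_mem (f : RepHom (convexRep K S hS) (convexRep K T hT)) {p : P}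
    (h : p ∈ S) :
    f.coeff p = (f.fiber p ⟨1, convexSub_pos K h ▸ Submodule.mem_top⟩ : K) := by
  rw [RepHom.coeff, dif_pos h]

theorem RepHom.coeff_of_notMem (f : RepHom (convexRep K S hS) (convexRep K T hT)) {p : P}
    (h : ¬(p ∈ S ∧ p ∈ T)) : f.coeff p = 0 := by
  by_cases hp : p ∈ S
  · rw [f.coeff_of_mem hp, ← Submodule.mem_bot K, ← convexSub_neg K fun hT => h ⟨hp, hT⟩]
    exact Subtype.property _
  · rw [RepHom.coeff, dif_neg hp]

theorem RepHom.fiber_eq_coeff_mul (f : RepHom (convexRep K S hS) (convexRep K T hT)) (p : P)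
    (x : convexSub K S p) : (f.fiber p x : K) = f.coeff p * x := by
  by_cases hp : p ∈ S
  · have hx : x = (x : K) •
        (⟨1, convexSub_pos K hp ▸ Submodule.mem_top⟩ : convexSub K S p) :=
      Subtype.ext (by simp)
    rw [f.coeff_of_mem hp]
    conv_lhs => rw [hx]
    rw [map_smul, Submodule.coe_smul, smul_eq_mul, mul_comm]
  · have hx : x = 0 :=
      Subtype.ext ((Submodule.mem_bot K).1 ((convexSub_neg K hp).le x.2))
    subst hx
    simp

theorem RepHom.coeff_eq_of_le (f : RepHom (convexRep K S hS) (convexRep K T hT)) {p q : P}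
    (hpq : p ≤ q) (hp : p ∈ S ∧ p ∈ T) (hq : q ∈ S ∧ q ∈ T) : f.coeff p = f.coeff q := by
  have h := congrArg (fun y : convexSub K T q => (y : K)) (LinearMap.congr_fun (f.natural hpq)
    (⟨1, convexSub_pos K hp.1 ▸ Submodule.mem_top⟩ : convexSub K S p))
  change ((phiMap K T T p q (f.fiber p _) : convexSub K T q) : K) =
    ((f.fiber q (phiMap K S S p q _) : convexSub K T q) : K) at h
  rw [phiMap, phiMap, dif_pos ⟨hp.2, hq.2⟩, dif_pos ⟨hp.1, hq.1⟩] at h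
  rw [f.coeff_of_mem hp.1, f.coeff_of_mem hq.1]
  exact h

/-- The zero morphism. -/
noncomputable def RepHom.zero : RepHom (convexRep K S hS) (convexRep K T hT) where
  app _ := 0
  natural _ := by simp

end Coeff

theorem RepHom.coeff_eq_of_isNVee {P : Type*} [PartialOrder P] [Finite P] {m : P}
    (hP : IsNVee P m) {K : Type*} [Field K] {S T : Set P} (hSconn : ConnectedIn S)
    (hTconn : ConnectedIn T) {hS : S.OrdConnected} {hT : T.OrdConnected}
    (f : RepHom (convexRep K S hS) (convexRep K T hT)) {p q : P}
    (hp : p ∈ S ∧ p ∈ T) (hq : q ∈ S ∧ q ∈ T) : f.coeff p = f.coeff q := by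
  by_cases hm : m ∈ S ∧ m ∈ T
  · rw [← f.coeff_eq_of_le (hP.le p) hm hp, f.coeff_eq_of_le (hP.le q) hm hq]
  · have hpq : p ≤ q ∨ q ≤ p := by
      by_cases hmS : m ∈ S
      · exact hP.comparable_of_notMem hTconn (fun hmT => hm ⟨hmS, hmT⟩) hp.2 hq.2
      · exact hP.comparable_of_notMem hSconn hmS hp.1 hq.1
    rcases hpq with h | h
    · exact f.coeff_eq_of_le h hp hq
    · exact (f.coeff_eq_of_le h hq hp).symm

/-- If `P` is an n-Vee and `I`, `M` are convex representations of `P`,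
then `Hom(I, M)` is at most one-dimensional: it is spanned by a single morphism. -/
theorem statement7 {P : Type*} [PartialOrder P] [Finite P] (m : P) (hP : IsNVee P m)
    {K : Type*} [Field K]
    (S T : Set P)
    (hSne : S.Nonempty) (hSconn : ConnectedIn S) (hSconv : S.OrdConnected)
    (hTne : T.Nonempty) (hTconn : ConnectedIn T) (hTconv : T.OrdConnected) :
    ∃ f₀ : RepHom (convexRep K S hSconv) (convexRep K T hTconv),
      ∀ f : RepHom (convexRep K S hSconv) (convexRep K T hTconv),
        ∃ c : K, ∀ p : P, f.app p = c • f₀.app p := by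
  by_cases h : ∃ (f : RepHom (convexRep K S hSconv) (convexRep K T hTconv)) (p : P), f.coeff p ≠ 0
  · obtain ⟨f₀, p, hp⟩ := h
    have hpST : p ∈ S ∧ p ∈ T := by
      by_contra hn
      exact hp (f₀.coeff_of_notMem hn)
    refine ⟨f₀, fun f => ⟨f.coeff p / f₀.coeff p, fun q =>
      LinearMap.ext fun (x : convexSub K S q) => Subtype.ext ?_⟩⟩
    change (f.fiber q x : K) =
      f.coeff p / f₀.coeff p * (f₀.fiber q x : K)
    rw [f.fiber_eq_coeff_mul, f₀.fiber_eq_coeff_mul]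
    by_cases hq : q ∈ S ∧ q ∈ T
    · rw [f.coeff_eq_of_isNVee hP hSconn hTconn hq hpST,
        f₀.coeff_eq_of_isNVee hP hSconn hTconn hq hpST]
      field_simp
    · rw [f.coeff_of_notMem hq, f₀.coeff_of_notMem hq]
      simp
  · push Not at h
    refine ⟨RepHom.zero, fun f => ⟨0, fun q =>
      LinearMap.ext fun (x : convexSub K S q) => Subtype.ext ?_⟩⟩
    change (f.fiber q x : K) = 0 * 0
    rw [f.fiber_eq_coeff_mul, h, zero_mul, zero_mul]

end GPM
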